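/- arXiv:2101.07658 — 2 statements merged into one kernel-verified Lean document; each statement's English description precedes it below -/
import Mathlib

section
/- Let Λ, B, s₁, …, s₆, W, ζ, W^ζ be as in the E₆ setup. Then the W^ζ-modules (1+ζ̄)(Λ/2Λ) and ker(1+ζ̄)/(1+ζ̄)(Λ/2Λ) are not isomorphic: there is no 𝔽₂-linear bijection between them commuting with the action induced by every element of W^ζ. Indeed, there exists w ∈ W^ζ whose mod-2 reduction w̄ acts as the identity on (1+ζ̄)(Λ/2Λ) but does not act as the identity on ker(1+ζ̄)/(1+ζ̄)(Λ/2Λ). -/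
/-- The Cartan matrix of type `E₆` in Bourbaki numbering. -/
def E6Cartan : Matrix (Fin 6) (Fin 6) ℤ :=
  !![2, 0, -1, 0, 0, 0;
     0, 2, 0, -1, 0, 0;
     -1, 0, 2, -1, 0, 0;
     0, -1, -1, 2, -1, 0;
     0, 0, 0, -1, 2, -1;
     0, 0, 0, 0, -1, 2]

/-- The symmetric bilinear form on the `E₆` root lattice `Λ = ℤ⁶` determined by the
Cartan matrix: `B(αᵢ, αⱼ) = Cᵢⱼ` on the standard basis. -/
def E6Form (v w : Fin 6 → ℤ) : ℤ := ∑ i, ∑ j, v i * E6Cartan i j * w j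

/-- The simple reflection `sᵢ(v) = v − B(v, αᵢ)·αᵢ`. -/
def E6refl (i : Fin 6) : Function.End (Fin 6 → ℤ) :=
  fun v => v - E6Form v (Pi.single i 1) • Pi.single i 1

/-- The Weyl group `W` of type `E₆`, realised as the submonoid of endomorphisms of `Λ`
generated by the simple reflections `s₁, …, s₆` (each reflection is an involution, so this
is the subgroup they generate). -/
def E6Weyl : Submonoid (Function.End (Fin 6 → ℤ)) :=
  Submonoid.closure (Set.range E6refl)

/-- The diagram automorphism on indices (0-indexed): `α₁↔α₆`, `α₃↔α₅`, fixing `α₂, α₄`. -/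
def E6zetaPerm : Fin 6 → Fin 6 := ![5, 1, 4, 3, 2, 0]

/-- The diagram involution `ζ` of `Λ`, sending `αᵢ ↦ α_{σ(i)}`. -/
def E6zeta : Function.End (Fin 6 → ℤ) := fun v j => v (E6zetaPerm j)

/-- Reduction modulo `2`, `Λ → Λ/2Λ ≅ 𝔽₂⁶`. -/
def red2 (v : Fin 6 → ℤ) : Fin 6 → ZMod 2 := fun i => (v i : ZMod 2)

/-- The map `ζ̄` induced by `ζ` on `Λ/2Λ ≅ 𝔽₂⁶`. -/
def zetaBar : (Fin 6 → ZMod 2) →ₗ[ZMod 2] (Fin 6 → ZMod 2) where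
  toFun x := fun j => x (E6zetaPerm j)
  map_add' := fun _ _ => rfl
  map_smul' := fun _ _ => rfl

/-- The linear map `1 + ζ̄` on `Λ/2Λ`. -/
def onePlusZetaBar : (Fin 6 → ZMod 2) →ₗ[ZMod 2] (Fin 6 → ZMod 2) :=
  LinearMap.id + zetaBar

theorem E6Form_single_one (v : Fin 6 → ℤ) : E6Form v (Pi.single 1 1) = 2 * v 1 - v 3 := by
  simp only [E6Form, Pi.single_apply, mul_ite, mul_one, mul_zero, Finset.sum_ite_eq',
    Finset.mem_univ, if_true]
  simp [E6Cartan, Fin.sum_univ_six]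
  ring

theorem E6refl_one_apply (v : Fin 6 → ℤ) :
    E6refl 1 v = Function.update v 1 (v 3 - v 1) := by
  rw [E6refl, E6Form_single_one]
  ext i
  by_cases hi : i = 1
  · subst hi
    simp
    ring
  · simp [hi]

theorem E6refl_one_comm_E6zeta : E6refl 1 * E6zeta = E6zeta * E6refl 1 := by
  funext v
  change E6refl 1 (E6zeta v) = E6zeta (E6refl 1 v)
  rw [E6refl_one_apply, E6refl_one_apply]
  ext i
  fin_cases i <;> simp [E6zeta, E6zetaPerm]

/-- The reduction modulo `2` of the reflection in the simple root `α₂`. -/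
def E6reflOneBar : (Fin 6 → ZMod 2) →ₗ[ZMod 2] (Fin 6 → ZMod 2) :=
  LinearMap.id + (LinearMap.proj 3).smulRight (Pi.single 1 1)

theorem E6reflOneBar_apply (x : Fin 6 → ZMod 2) :
    E6reflOneBar x = x + x 3 • Pi.single 1 1 := rfl

theorem E6reflOneBar_red2 (v : Fin 6 → ℤ) : E6reflOneBar (red2 v) = red2 (E6refl 1 v) := by
  rw [E6refl_one_apply, E6reflOneBar_apply]
  ext i
  by_cases hi : i = 1
  · subst hi
    simp [red2, sub_eq_add_neg, CharTwo.neg_eq, add_comm]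
  · simp [red2, hi]

/-- A vector in the image of `1 + ζ̄` vanishes at every index fixed by `ζ`. -/
theorem apply_eq_zero_of_mem_range_onePlusZetaBar {x : Fin 6 → ZMod 2}
    (hx : x ∈ LinearMap.range onePlusZetaBar) {j : Fin 6} (hj : E6zetaPerm j = j) :
    x j = 0 := by
  obtain ⟨y, rfl⟩ := hx
  simp [onePlusZetaBar, zetaBar, hj, CharTwo.add_self_eq_zero]

/-- A basis vector at an index fixed by `ζ` lies in the kernel of `1 + ζ̄`. -/
theorem single_mem_ker_onePlusZetaBar {j : Fin 6} (hj : E6zetaPerm j = j) :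
    (Pi.single j 1 : Fin 6 → ZMod 2) ∈ LinearMap.ker onePlusZetaBar := by
  rw [LinearMap.mem_ker]
  revert j
  decide

theorem single_one_notMem_range_onePlusZetaBar :
    (Pi.single 1 1 : Fin 6 → ZMod 2) ∉ LinearMap.range onePlusZetaBar := fun h => by
  simpa using apply_eq_zero_of_mem_range_onePlusZetaBar h (j := 1) rfl

theorem E6reflOneBar_of_mem_range {x : Fin 6 → ZMod 2}
    (hx : x ∈ LinearMap.range onePlusZetaBar) : E6reflOneBar x = x := by
  simp [E6reflOneBar_apply, apply_eq_zero_of_mem_range_onePlusZetaBar hx (j := 3) rfl]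

theorem E6reflOneBar_single_three_sub :
    E6reflOneBar (Pi.single 3 1) - Pi.single 3 1 = Pi.single 1 1 := by
  simp [E6reflOneBar_apply]

theorem E6refl_mem_E6Weyl (i : Fin 6) : E6refl i ∈ E6Weyl :=
  Submonoid.subset_closure ⟨i, rfl⟩

/-- The `W^ζ`-modules `(1+ζ̄)(Λ/2Λ)` and `ker(1+ζ̄)/(1+ζ̄)(Λ/2Λ)` are not isomorphic:
there is no 𝔽₂-linear bijection between them commuting with the action induced by every
element of `W^ζ`. Indeed, there exists `w ∈ W^ζ` whose mod-2 reduction acts as the identity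
on `(1+ζ̄)(Λ/2Λ)` but not on `ker(1+ζ̄)/(1+ζ̄)(Λ/2Λ)`. -/
theorem wzeta_graded_pieces_not_isomorphic :
    (¬ ∃ e : ↥(LinearMap.range onePlusZetaBar) ≃ₗ[ZMod 2]
        (↥(LinearMap.ker onePlusZetaBar) ⧸
          (LinearMap.range onePlusZetaBar).comap (LinearMap.ker onePlusZetaBar).subtype),
      ∀ w : Function.End (Fin 6 → ℤ), w ∈ E6Weyl → w * E6zeta = E6zeta * w →
        ∀ u : (Fin 6 → ZMod 2) →ₗ[ZMod 2] (Fin 6 → ZMod 2),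
          (∀ v : Fin 6 → ℤ, u (red2 v) = red2 (w v)) →
          ∀ (x k : Fin 6 → ZMod 2) (hx : x ∈ LinearMap.range onePlusZetaBar)
            (hk : k ∈ LinearMap.ker onePlusZetaBar)
            (hux : u x ∈ LinearMap.range onePlusZetaBar)
            (huk : u k ∈ LinearMap.ker onePlusZetaBar),
            e ⟨x, hx⟩ = Submodule.Quotient.mk ⟨k, hk⟩ →
            e ⟨u x, hux⟩ = Submodule.Quotient.mk ⟨u k, huk⟩) ∧
    (∃ w : Function.End (Fin 6 → ℤ), w ∈ E6Weyl ∧ w * E6zeta = E6zeta * w ∧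
      (∀ v : Fin 6 → ℤ, red2 v ∈ LinearMap.range onePlusZetaBar → red2 (w v) = red2 v) ∧
      (∃ v : Fin 6 → ℤ, red2 v ∈ LinearMap.ker onePlusZetaBar ∧
        red2 (w v) - red2 v ∉ LinearMap.range onePlusZetaBar)) := by
 
  have hk := single_mem_ker_onePlusZetaBar (j := 3) rfl
  refine ⟨?_, E6refl 1, E6refl_mem_E6Weyl 1, E6refl_one_comm_E6zeta, fun v hv => ?_,
    Pi.single 3 1, ?_⟩
  · rintro ⟨e, he⟩
    have huk : E6reflOneBar (Pi.single 3 1) ∈ LinearMap.ker onePlusZetaBar := by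
      rw [← sub_add_cancel (E6reflOneBar (Pi.single 3 1)) (Pi.single 3 1),
        E6reflOneBar_single_three_sub]
      exact add_mem (single_mem_ker_onePlusZetaBar rfl) hk
    obtain ⟨⟨x, hx⟩, hxk⟩ := e.surjective (Submodule.Quotient.mk ⟨Pi.single 3 1, hk⟩)
    have hfix := E6reflOneBar_of_mem_range hx
    have hux : E6reflOneBar x ∈ LinearMap.range onePlusZetaBar := hfix.symm ▸ hx
    have h := he (E6refl 1) (E6refl_mem_E6Weyl 1) E6refl_one_comm_E6zeta E6reflOneBar
      E6reflOneBar_red2 x _ hx hk hux huk hxk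
    simp only [hfix] at h
    have hmem := (Submodule.Quotient.eq _).mp (h.symm.trans hxk)
    rw [Submodule.mem_comap] at hmem
    refine single_one_notMem_range_onePlusZetaBar ?_
    rw [← E6reflOneBar_single_three_sub]
    exact hmem
  · rw [← E6reflOneBar_red2, E6reflOneBar_of_mem_range hv]
  · have hred : red2 (Pi.single 3 1) = Pi.single 3 1 := by decide
    rw [← E6reflOneBar_red2, hred, E6reflOneBar_single_three_sub]
    exact ⟨hk, single_one_notMem_range_onePlusZetaBar⟩
end

section
/- Let Λ, B, s₁, …, s₆, W, ζ be as in the E₆ setup. The element w = s₁ ∘ s₆ ∘ s₂ ∘ s₃ ∘ s₅ ∘ s₄ of W commutes with ζ, and its mod-2 reduction w̄ : Λ/2Λ → Λ/2Λ has no nonzero fixed vector, i.e. ker(w̄ − id) = 0 in 𝔽₂⁶. -/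
/-- The Coxeter element `w = s₁∘s₆∘s₂∘s₃∘s₅∘s₄` of `W(E₆)` (in `Function.End`,
multiplication is composition; the indices are 0-indexed). -/
def coxE6 : Function.End (Fin 6 → ℤ) :=
  E6refl 0 * E6refl 5 * E6refl 1 * E6refl 2 * E6refl 4 * E6refl 3

/-- The simple reflection `sᵢ` changes only the `i`-th coordinate. -/
theorem E6refl_apply (i : Fin 6) (v : Fin 6 → ℤ) :
    E6refl i v = Function.update v i (v i - ∑ k, v k * E6Cartan k i) := by
  funext j
  by_cases h : j = i
  · subst h
    simp [E6refl, E6Form, Pi.single_apply]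
  · simp [E6refl, h]

/-- The Coxeter element in coordinates. -/
theorem coxE6_apply (v : Fin 6 → ℤ) :
    coxE6 v = ![v 1 + v 4 - v 3, v 2 + v 4 - v 3, v 0 + v 1 + v 4 - v 3,
      v 1 + v 2 + v 4 - v 3, v 1 + v 2 + v 5 - v 3, v 1 + v 2 - v 3] := by
  change E6refl 0 (E6refl 5 (E6refl 1 (E6refl 2 (E6refl 4 (E6refl 3 v))))) = _
  simp only [E6refl_apply]
  funext j
  fin_cases j <;> simp [Fin.sum_univ_six, E6Cartan, Function.update_apply] <;> ring

theorem coxE6_mem_E6Weyl : coxE6 ∈ E6Weyl := by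
  have h (i : Fin 6) : E6refl i ∈ E6Weyl := Submonoid.subset_closure ⟨i, rfl⟩
  exact mul_mem (mul_mem (mul_mem (mul_mem (mul_mem (h _) (h _)) (h _)) (h _)) (h _)) (h _)

theorem coxE6_mul_E6zeta : coxE6 * E6zeta = E6zeta * coxE6 := by
  funext v
  change coxE6 (E6zeta v) = E6zeta (coxE6 v)
  funext j
  fin_cases j <;> simp [coxE6_apply, E6zeta, E6zetaPerm] <;> ring

/-- Two lattice vectors agree modulo `2` iff their coordinates are congruent modulo `2`. -/
theorem red2_eq_red2_iff (v w : Fin 6 → ℤ) : red2 v = red2 w ↔ ∀ i, v i ≡ w i [ZMOD 2] := by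
  simp only [funext_iff, red2]
  exact forall_congr' fun i => ZMod.intCast_eq_intCast_iff (v i) (w i) 2

theorem red2_eq_zero_of_red2_coxE6_eq (v : Fin 6 → ℤ) (h : red2 (coxE6 v) = red2 v) :
    red2 v = 0 := by
  have h0 : red2 0 = 0 := by funext i; simp [red2]
  rw [red2_eq_red2_iff, coxE6_apply] at h
  rw [← h0, red2_eq_red2_iff]
  have e0 : v 1 + v 4 - v 3 ≡ v 0 [ZMOD 2] := h 0
  have e1 : v 2 + v 4 - v 3 ≡ v 1 [ZMOD 2] := h 1
  have e2 : v 0 + v 1 + v 4 - v 3 ≡ v 2 [ZMOD 2] := h 2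
  have e3 : v 1 + v 2 + v 4 - v 3 ≡ v 3 [ZMOD 2] := h 3
  have e4 : v 1 + v 2 + v 5 - v 3 ≡ v 4 [ZMOD 2] := h 4
  have e5 : v 1 + v 2 - v 3 ≡ v 5 [ZMOD 2] := h 5
  clear h h0
  simp only [Int.modEq_iff_dvd] at *
  intro i
  fin_cases i <;> simp only [Fin.reduceFinMk, Fin.zero_eta, Fin.mk_one, Pi.zero_apply] <;> omega

/-- The Coxeter element `w = s₁s₆s₂s₃s₅s₄` of `W(E₆)` commutes with the diagram involution
`ζ`, and its mod-2 reduction on `Λ/2Λ ≅ 𝔽₂⁶` has no nonzero fixed vector. -/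
theorem coxeter_element_no_fixed_vector :
    coxE6 ∈ E6Weyl ∧
    coxE6 * E6zeta = E6zeta * coxE6 ∧
    ∀ v : Fin 6 → ℤ, red2 (coxE6 v) = red2 v → red2 v = 0 :=
  ⟨coxE6_mem_E6Weyl, coxE6_mul_E6zeta, red2_eq_zero_of_red2_coxE6_eq⟩
end
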